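/- Let d be a nonnegative integer and let X, Y, Z be the triple of linear maps on K^{d+1} of type B(d) (with d even) or of type AB(d,0). Then each of X, Y, Z is diagonalizable. Moreover, for type B(d) the set of eigenvalues of each of X, Y, Z is {(−1)^i (d−2i) : 0 ≤ i ≤ d}, and for type AB(d,0) the set of eigenvalues of each of X, Y, Z is {(−1)^{d+i}(2d−2i+1) : 0 ≤ i ≤ d}. -/

import Mathlib

/-- The matrix of `X` for the module of type `B(d)`:
`X v_i = (−1)^i (d − 2i) v_i`. -/
def matBX (K : Type*) [Field K] (d : ℕ) : Matrix (Fin (d + 1)) (Fin (d + 1)) K :=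
  fun j i =>
    if j = i then ((((-1 : ℤ) ^ (i : ℕ)) * ((d : ℤ) - 2 * ((i : ℕ) : ℤ)) : ℤ) : K)
    else 0

/-- The matrix of `Y` for the module of type `B(d)`:
`Y v_i = (d − i + 1) v_{i−1} + (i + 1) v_{i+1}` with `v_{−1} = 0`, `v_{d+1} = 0`. -/
def matBY (K : Type*) [Field K] (d : ℕ) : Matrix (Fin (d + 1)) (Fin (d + 1)) K :=
  fun j i =>
    if (j : ℕ) + 1 = (i : ℕ) then (((d : ℤ) - ((i : ℕ) : ℤ) + 1 : ℤ) : K)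
    else if (i : ℕ) + 1 = (j : ℕ) then ((((i : ℕ) : ℤ) + 1 : ℤ) : K)
    else 0

/-- The matrix of `Z` for the module of type `B(d)`:
`Z v_i = (−1)^{i−1}(d − i + 1) v_{i−1} + (−1)^i (i + 1) v_{i+1}`
with `v_{−1} = 0`, `v_{d+1} = 0`. -/
def matBZ (K : Type*) [Field K] (d : ℕ) : Matrix (Fin (d + 1)) (Fin (d + 1)) K :=
  fun j i =>
    if (j : ℕ) + 1 = (i : ℕ) then
      ((((-1 : ℤ) ^ ((i : ℕ) + 1)) * ((d : ℤ) - ((i : ℕ) : ℤ) + 1) : ℤ) : K)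
    else if (i : ℕ) + 1 = (j : ℕ) then
      ((((-1 : ℤ) ^ (i : ℕ)) * (((i : ℕ) : ℤ) + 1) : ℤ) : K)
    else 0

/-- The matrix of `X` for the module of type `AB(d,0)`:
`X v_i = (−1)^{d+i}(2d − 2i + 1) v_i`. -/
def matABX (K : Type*) [Field K] (d : ℕ) : Matrix (Fin (d + 1)) (Fin (d + 1)) K :=
  fun j i =>
    if j = i then
      ((((-1 : ℤ) ^ (d + (i : ℕ))) * (2 * (d : ℤ) - 2 * ((i : ℕ) : ℤ) + 1) : ℤ) : K)
    else 0

/-- The matrix of `Y` for the module of type `AB(d,0)`: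
`Y v_i = (−1)^d (2d − i + 2) v_{i−1} + (−1)^d (i + 1) v_{i+1}`
with `v_{−1} = 0`, `v_{d+1} = v_d`. -/
def matABY (K : Type*) [Field K] (d : ℕ) : Matrix (Fin (d + 1)) (Fin (d + 1)) K :=
  fun j i =>
    if (j : ℕ) + 1 = (i : ℕ) then
      ((((-1 : ℤ) ^ d) * (2 * (d : ℤ) - ((i : ℕ) : ℤ) + 2) : ℤ) : K)
    else if (i : ℕ) + 1 = (j : ℕ) then
      ((((-1 : ℤ) ^ d) * (((i : ℕ) : ℤ) + 1) : ℤ) : K)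
    else if j = i ∧ (i : ℕ) = d then
      ((((-1 : ℤ) ^ d) * ((d : ℤ) + 1) : ℤ) : K)
    else 0

/-- The matrix of `Z` for the module of type `AB(d,0)`:
`Z v_i = (−1)^{i−1}(2d − i + 2) v_{i−1} + (−1)^i (i + 1) v_{i+1}`
with `v_{−1} = 0`, `v_{d+1} = v_d`. -/
def matABZ (K : Type*) [Field K] (d : ℕ) : Matrix (Fin (d + 1)) (Fin (d + 1)) K :=
  fun j i =>
    if (j : ℕ) + 1 = (i : ℕ) then
      ((((-1 : ℤ) ^ ((i : ℕ) + 1)) * (2 * (d : ℤ) - ((i : ℕ) : ℤ) + 2) : ℤ) : K)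
    else if (i : ℕ) + 1 = (j : ℕ) then
      ((((-1 : ℤ) ^ (i : ℕ)) * (((i : ℕ) : ℤ) + 1) : ℤ) : K)
    else if j = i ∧ (i : ℕ) = d then
      ((((-1 : ℤ) ^ (i : ℕ)) * ((d : ℤ) + 1) : ℤ) : K)
    else 0

/-- The eigenspace of a linear map `f` for the scalar `μ`. -/
def eigSp {K V : Type*} [Field K] [AddCommGroup V] [Module K V]
    (f : V →ₗ[K] V) (μ : K) : Submodule K V :=
  LinearMap.ker (f - μ • LinearMap.id)

section Diagonalization

variable {K : Type*} [Field K]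

theorem eigSp_eq_eigenspace {V : Type*} [AddCommGroup V] [Module K V]
    (f : V →ₗ[K] V) (μ : K) : eigSp f μ = Module.End.eigenspace f μ := by
  ext x
  simp [eigSp, sub_eq_zero]

/-- An endomorphism with as many distinct eigenvalues as the dimension is diagonalizable,
and has no further eigenvalues. -/
theorem iSup_eigSp_eq_top_and_eigenvalues {ι V : Type*} [Fintype ι]
    [AddCommGroup V] [Module K V] [FiniteDimensional K V]
    (hcard : Fintype.card ι = Module.finrank K V) (f : V →ₗ[K] V) (μ : ι → K)
    (hμ : Function.Injective μ) (hv : ∀ i, ∃ v, v ≠ 0 ∧ f v = μ i • v) :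
    (⨆ ν : K, eigSp f ν) = ⊤ ∧ {ν : K | eigSp f ν ≠ ⊥} = {ν : K | ∃ i, ν = μ i} := by
  choose v hv0 hv using hv
  have hmem : ∀ i, v i ∈ Module.End.eigenspace f (μ i) := fun i =>
    Module.End.mem_eigenspace_iff.2 (hv i)
  have hli := Module.End.eigenvectors_linearIndependent' f μ hμ v fun i => ⟨hmem i, hv0 i⟩
  have htop : (⨆ i, Module.End.eigenspace f (μ i)) = ⊤ := by
    rw [eq_top_iff, ← hli.span_eq_top_of_card_eq_finrank' hcard, Submodule.span_le]
    rintro _ ⟨i, rfl⟩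
    exact Submodule.mem_iSup_of_mem i (hmem i)
  simp only [eigSp_eq_eigenspace]
  refine ⟨eq_top_iff.2 (htop ▸ iSup_le fun i => le_iSup (Module.End.eigenspace f) (μ i)), ?_⟩
  ext ν
  constructor
  · intro hν
    by_contra hne
    refine hν (disjoint_top.1 ?_)
    refine (Module.End.eigenspaces_iSupIndep f ν).mono_right ?_
    rw [← htop]
    exact iSup_le fun i => le_iSup₂_of_le (μ i) (fun h => hne ⟨i, h.symm⟩) le_rfl
  · rintro ⟨i, rfl⟩ hbot
    exact hv0 i ((Submodule.mem_bot K).1 (hbot ▸ hmem i))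

end Diagonalization

section Krawtchouk

open Polynomial

variable {K : Type*} [Field K]

/-- The generating polynomial `(1 + x)^a (1 - x)^b` of the Krawtchouk numbers. -/
noncomputable def krawtchoukGen (K : Type*) [Field K] (a b : ℕ) : K[X] :=
  (1 + X) ^ a * (1 - X) ^ b

theorem krawtchoukGen_derivative (a b : ℕ) :
    (1 - X ^ 2) * derivative (krawtchoukGen K a b) =
      (C ((a : K) - b) - C ((a : K) + b) * X) * krawtchoukGen K a b := by
  have hpow : ∀ (p : K[X]) (m : ℕ), (m : K[X]) * p ^ (m - 1) * p = m * p ^ m := by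
    intro p m
    rcases m with _ | m
    · simp
    · rw [Nat.add_sub_cancel, pow_succ]; ring
  have h₁ := hpow (1 + X) a
  have h₂ := hpow (1 - X) b
  simp only [krawtchoukGen, derivative_mul, derivative_pow,
    derivative_one, derivative_X, map_sub, map_add, map_natCast]
  linear_combination ((1 - X) * (1 - X) ^ b) * h₁ - ((1 + X) * (1 + X) ^ a) * h₂

theorem krawtchoukGen_coeff_zero (a b : ℕ) : (krawtchoukGen K a b).coeff 0 = 1 := by
  simp [krawtchoukGen, coeff_zero_eq_eval_zero]

theorem krawtchoukGen_coeff_one (a b : ℕ) :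
    (krawtchoukGen K a b).coeff 1 = (a : K) - b := by
  have h := congrArg (fun p => coeff p 0) (krawtchoukGen_derivative (K := K) a b)
  simpa [coeff_derivative, mul_coeff_zero, krawtchoukGen_coeff_zero] using h

theorem krawtchoukGen_coeff_rec (a b j : ℕ) :
    ((j : K) + 2) * (krawtchoukGen K a b).coeff (j + 2) +
        ((a : K) + b - j) * (krawtchoukGen K a b).coeff j =
      ((a : K) - b) * (krawtchoukGen K a b).coeff (j + 1) := by
  have h := congrArg (fun p => coeff p (j + 1)) (krawtchoukGen_derivative (K := K) a b)
  simp only [sub_mul, one_mul, mul_assoc, coeff_sub, coeff_C_mul, coeff_X_mul, pow_two] at h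
  rcases j with _ | j
  · simp [coeff_derivative, mul_coeff_zero] at h ⊢
    linear_combination h
  · simp [coeff_derivative, coeff_X_mul] at h ⊢
    linear_combination h

theorem reflect_linear_pow (c : K) (a : ℕ) :
    reflect a ((1 + C c * X) ^ a) = (X + C c) ^ a := by
  have hdeg : ∀ m : ℕ, ((1 + C c * X) ^ m).natDegree ≤ m := fun m => by
    compute_degree
  induction a with
  | zero => simp
  | succ a ih =>
    have h₁ : reflect 1 (1 + C c * X) = X + C c := by
      have h := reflect_C_mul_X_pow 1 1 (c := c)
      rw [pow_one, revAt_le le_rfl] at h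
      rw [reflect_add, h, ← C_1, reflect_C]
      simp
    rw [pow_succ, reflect_mul _ _ (hdeg a) (by simpa using hdeg 1), ih, h₁, pow_succ]

theorem krawtchoukGen_coeff_symm {a b j : ℕ} (hb : Even b) (hj : j ≤ a + b) :
    (krawtchoukGen K a b).coeff (a + b - j) = (krawtchoukGen K a b).coeff j := by
  have hrefl : reflect (a + b) (krawtchoukGen K a b) = krawtchoukGen K a b := by
    have h₁ : (1 + X : K[X]) = 1 + C 1 * X := by simp
    have h₂ : (1 - X : K[X]) = 1 + C (-1) * X := by simp [sub_eq_add_neg]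
    have h₃ : (X + C (-1) : K[X]) = -(1 - X) := by simp; ring
    rw [krawtchoukGen, reflect_mul, h₁, h₂, reflect_linear_pow, reflect_linear_pow, ← h₂, h₃,
      hb.neg_pow]
    · simp [add_comm]
    · compute_degree
    · compute_degree
  rw [← revAt_le hj, ← coeff_reflect, hrefl]

/-- The values, indexed by `j`, of the Krawtchouk polynomial of degree `b` on
`{0, …, a + b}`, normalized to be `1` at `j = 0`. -/
noncomputable def krawtchouk (K : Type*) [Field K] (a b j : ℕ) : K :=
  (krawtchoukGen K a b).coeff j / (a + b).choose j

theorem krawtchouk_zero (a b : ℕ) : krawtchouk K a b 0 = 1 := by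
  simp [krawtchouk, krawtchoukGen_coeff_zero]

theorem krawtchouk_symm {a b j : ℕ} (hb : Even b) (hj : j ≤ a + b) :
    krawtchouk K a b (a + b - j) = krawtchouk K a b j := by
  rw [krawtchouk, krawtchouk, krawtchoukGen_coeff_symm hb hj, Nat.choose_symm hj]

theorem sub_mul_krawtchouk_succ [CharZero K] {a b j : ℕ} (hj : j ≤ a + b) :
    ((a + b : ℕ) - (j : K)) * krawtchouk K a b (j + 1) =
      ((j : K) + 1) * (krawtchoukGen K a b).coeff (j + 1) / (a + b).choose j := by
  have hc : ((a + b).choose j : K) ≠ 0 := Nat.cast_ne_zero.2 (Nat.choose_pos hj).ne'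
  rcases hj.eq_or_lt with rfl | hlt
  · have hdeg : (krawtchoukGen K a b).natDegree ≤ a + b := by
      rw [krawtchoukGen]; compute_degree
    rw [coeff_eq_zero_of_natDegree_lt (by omega)]
    simp
  · have hc' : ((a + b).choose (j + 1) : K) ≠ 0 :=
      Nat.cast_ne_zero.2 (Nat.choose_pos hlt).ne'
    have h : ((a + b).choose (j + 1) : K) * (j + 1) =
        (a + b).choose j * ((a + b : ℕ) - (j : K)) := by
      rw [← Nat.cast_sub hj]
      exact_mod_cast Nat.choose_succ_right_eq (a + b) j
    rw [krawtchouk, ← mul_div_assoc, div_eq_div_iff hc' hc]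
    linear_combination -(krawtchoukGen K a b).coeff (j + 1) * h

theorem krawtchouk_rec_zero [CharZero K] (a b : ℕ) :
    ((a + b : ℕ) : K) * krawtchouk K a b 1 = ((a : K) - b) * krawtchouk K a b 0 := by
  have h := sub_mul_krawtchouk_succ (K := K) (Nat.zero_le (a + b))
  simpa [krawtchouk_zero, krawtchoukGen_coeff_one] using h

theorem krawtchouk_rec_succ [CharZero K] {a b j : ℕ} (hj : j + 1 ≤ a + b) :
    ((a + b : ℕ) - ((j : K) + 1)) * krawtchouk K a b (j + 2) +
      ((j : K) + 1) * krawtchouk K a b j = ((a : K) - b) * krawtchouk K a b (j + 1) := by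
  have hc : ((a + b).choose j : K) ≠ 0 := Nat.cast_ne_zero.2 (Nat.choose_pos (by omega)).ne'
  have hc' : ((a + b).choose (j + 1) : K) ≠ 0 := Nat.cast_ne_zero.2 (Nat.choose_pos hj).ne'
  have h : ((a + b).choose (j + 1) : K) * (j + 1) =
      (a + b).choose j * ((a : K) + b - j) := by
    rw [← Nat.cast_add, ← Nat.cast_sub (by omega : j ≤ a + b)]
    exact_mod_cast Nat.choose_succ_right_eq (a + b) j
  have hs := sub_mul_krawtchouk_succ (K := K) hj
  have hr := krawtchoukGen_coeff_rec (K := K) a b j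
  rw [Nat.cast_add j, Nat.cast_one] at hs
  rw [hs, krawtchouk, krawtchouk]
  field_simp
  linear_combination ((a + b).choose j : K) * hr + (krawtchoukGen K a b).coeff j * h

end Krawtchouk

section Tridiagonal

variable {K : Type*} [Field K]

/-- The action of a tridiagonal matrix whose only nonzero diagonal entry is the last one. -/
theorem tridiagonal_mulVec (d : ℕ) (u l w : ℕ → K) (t : K)
    (M : Matrix (Fin (d + 1)) (Fin (d + 1)) K)
    (hM : ∀ j i : Fin (d + 1), M j i =
      if (j : ℕ) + 1 = i then u j else if (i : ℕ) + 1 = j then l i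
      else if j = i ∧ (i : ℕ) = d then t else 0) (j : Fin (d + 1)) :
    (M.mulVec fun i => w i) j =
      (if (j : ℕ) = d then t * w d else u j * w (j + 1)) +
        if (j : ℕ) = 0 then 0 else l (j - 1) * w (j - 1) := by
  have hsplit : ∀ i : Fin (d + 1), M j i * w i =
      (if (j : ℕ) + 1 = i then u j * w i else 0) +
      (if (j : ℕ) = d then (if j = i then t * w i else 0) else 0) +
      (if (j : ℕ) = 0 then 0 else if (i : ℕ) = j - 1 then l i * w i else 0) := by
    intro i
    simp only [hM, Fin.ext_iff]
    split_ifs <;> first | omega | simp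
  simp only [Matrix.mulVec, dotProduct, hsplit, Finset.sum_add_distrib]
  congr 1
  · by_cases hj : (j : ℕ) = d
    · rw [Finset.sum_eq_zero fun i _ => if_neg (by omega)]
      simp [hj]
    · have hlt : (j : ℕ) + 1 < d + 1 := by omega
      rw [Finset.sum_eq_single (⟨j + 1, hlt⟩ : Fin (d + 1))]
      · simp [hj]
      · intro i _ hi
        exact if_neg fun h => hi (Fin.ext h.symm)
      · simp
  · by_cases hj : (j : ℕ) = 0
    · simp [hj]
    · have hlt : (j : ℕ) - 1 < d + 1 := by omega
      rw [Finset.sum_eq_single (⟨j - 1, hlt⟩ : Fin (d + 1))]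
      · simp [hj]
      · intro i _ hi
        rw [if_neg hj, if_neg fun h => hi (Fin.ext h)]
      · simp

/-- The (folded, sign-twisted) Kac matrix has a Krawtchouk eigenvector. -/
theorem exists_eigenvector_kac [CharZero K] {d a b : ℕ} (hd : d ≤ a + b) (η t : K) (ε : ℕ → K)
    (hε : ∀ j, ε j * ε j = 1)
    (ht : t * krawtchouk K a b d = ((a + b : ℕ) - (d : K)) * krawtchouk K a b (d + 1))
    (M : Matrix (Fin (d + 1)) (Fin (d + 1)) K)
    (hM : ∀ j i : Fin (d + 1), M j i =
      if (j : ℕ) + 1 = i then η * ε j * ((a + b : ℕ) - ((j : ℕ) : K))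
      else if (i : ℕ) + 1 = j then η * ε i * (((i : ℕ) : K) + 1)
      else if j = i ∧ (i : ℕ) = d then η * t else 0) :
    ∃ v, v ≠ 0 ∧ Matrix.toLin' M v = (η * ((a : K) - b)) • v := by
  let s : ℕ → K := fun j => ∏ i ∈ Finset.range j, ε i
  have hs : ∀ j, s (j + 1) = s j * ε j := fun j => Finset.prod_range_succ _ _
  refine ⟨fun i => s i * krawtchouk K a b i, fun h => ?_, ?_⟩
  · simpa [s, krawtchouk_zero] using congrFun h 0
  · ext j
    rw [Matrix.toLin'_apply, tridiagonal_mulVec d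
      (fun j => η * ε j * ((a + b : ℕ) - (j : K))) (fun i => η * ε i * ((i : K) + 1))
      (fun i => s i * krawtchouk K a b i) (η * t) M hM, Pi.smul_apply, smul_eq_mul]
    have hup : (if (j : ℕ) = d then η * t * (s d * krawtchouk K a b d)
        else η * ε j * ((a + b : ℕ) - ((j : ℕ) : K)) * (s (j + 1) * krawtchouk K a b (j + 1))) =
        η * s j * (((a + b : ℕ) - ((j : ℕ) : K)) * krawtchouk K a b (j + 1)) := by
      split_ifs with hj
      · rw [hj, ← ht]; ring
      · rw [hs]
        linear_combination η * s j * ((a + b : ℕ) - ((j : ℕ) : K)) *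
          krawtchouk K a b (j + 1) * hε j
    rw [hup]
    obtain ⟨j, hj⟩ := j
    rcases j with _ | j
    · have h := krawtchouk_rec_zero (K := K) a b
      simp only [if_true, Nat.cast_zero, sub_zero, zero_add, add_zero]
      linear_combination η * s 0 * h
    · have h := krawtchouk_rec_succ (K := K) (a := a) (b := b) (j := j) (by omega)
      simp only [Nat.add_sub_cancel, Nat.cast_add, Nat.cast_one, hs, Nat.succ_ne_zero,
        if_false] at h ⊢
      linear_combination η * s j * ε j * h

end Tridiagonal

section Spectrum

theorem eq_of_signed_eq {n i j : ℕ} (hn : Even n ∨ i + j < n)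
    (h : (-1 : ℤ) ^ i * ((n : ℤ) - 2 * i) = (-1) ^ j * ((n : ℤ) - 2 * j)) : i = j := by
  rcases Nat.even_or_odd i with hi | hi <;> rcases Nat.even_or_odd j with hj | hj <;>
    rw [hi.neg_one_pow, hj.neg_one_pow] at h <;> grind

/-- The signed eigenvalue `(-1)^i (n - 2 i)` is `a - b` for a splitting `n = a + b`. -/
theorem exists_splitting {n i : ℕ} (hi : i ≤ n) :
    ∃ a b : ℕ, a + b = n ∧ (Odd n → Even b) ∧
      (-1 : ℤ) ^ i * ((n : ℤ) - 2 * i) = (a : ℤ) - b := by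
  rcases Nat.even_or_odd i with h | h
  · exact ⟨n - i, i, by omega, fun _ => h, by rw [h.neg_one_pow]; omega⟩
  · refine ⟨i, n - i, by omega, fun hn => Nat.Odd.sub_odd hn h, ?_⟩
    rw [h.neg_one_pow]; omega

variable {K : Type*} [Field K] [CharZero K]

theorem spectrum_of_eigenvectors (n d : ℕ) (e : ℕ) (hnd : Even n ∨ 2 * d < n)
    (M : Matrix (Fin (d + 1)) (Fin (d + 1)) K)
    (hv : ∀ i : Fin (d + 1), ∃ v, v ≠ 0 ∧ Matrix.toLin' M v =
      (((-1 : ℤ) ^ (e + (i : ℕ)) * ((n : ℤ) - 2 * ((i : ℕ) : ℤ)) : ℤ) : K) • v) :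
    (⨆ μ : K, eigSp (Matrix.toLin' M) μ) = ⊤ ∧
      {μ : K | eigSp (Matrix.toLin' M) μ ≠ ⊥} = {μ : K | ∃ i : Fin (d + 1),
        μ = (((-1 : ℤ) ^ (e + (i : ℕ)) * ((n : ℤ) - 2 * ((i : ℕ) : ℤ)) : ℤ) : K)} := by
  refine iSup_eigSp_eq_top_and_eigenvalues (by simp) _ _ (fun i j hij => ?_) hv
  have h := Int.cast_injective (α := K) hij
  rw [pow_add, pow_add, mul_assoc, mul_assoc] at h
  refine Fin.ext (eq_of_signed_eq (hnd.imp_right fun h => by omega)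
    (mul_left_cancel₀ (pow_ne_zero e (by norm_num)) h))

theorem spectrum_signedDiagonal (n d e : ℕ) (hnd : Even n ∨ 2 * d < n)
    (M : Matrix (Fin (d + 1)) (Fin (d + 1)) K)
    (hM : ∀ j i : Fin (d + 1), M j i = if j = i then
      (((-1 : ℤ) ^ (e + (i : ℕ)) * ((n : ℤ) - 2 * ((i : ℕ) : ℤ)) : ℤ) : K) else 0) :
    (⨆ μ : K, eigSp (Matrix.toLin' M) μ) = ⊤ ∧
      {μ : K | eigSp (Matrix.toLin' M) μ ≠ ⊥} = {μ : K | ∃ i : Fin (d + 1),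
        μ = (((-1 : ℤ) ^ (e + (i : ℕ)) * ((n : ℤ) - 2 * ((i : ℕ) : ℤ)) : ℤ) : K)} := by
  refine spectrum_of_eigenvectors n d e hnd M fun i => ⟨Pi.single i 1, by simp, ?_⟩
  ext j
  rw [Matrix.toLin'_apply, Matrix.mulVec_single_one, Matrix.col_apply, hM]
  by_cases h : j = i <;> simp [h]

theorem spectrum_kac (n d e : ℕ) (t : K) (ε : ℕ → K)
    (hnd : Even n ∧ n = d ∧ t = 0 ∨ n = 2 * d + 1 ∧ t = d + 1) (hε : ∀ j, ε j * ε j = 1)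
    (M : Matrix (Fin (d + 1)) (Fin (d + 1)) K)
    (hM : ∀ j i : Fin (d + 1), M j i =
      if (j : ℕ) + 1 = i then (-1) ^ e * ε j * ((n : K) - ((j : ℕ) : K))
      else if (i : ℕ) + 1 = j then (-1) ^ e * ε i * (((i : ℕ) : K) + 1)
      else if j = i ∧ (i : ℕ) = d then (-1) ^ e * t else 0) :
    (⨆ μ : K, eigSp (Matrix.toLin' M) μ) = ⊤ ∧
      {μ : K | eigSp (Matrix.toLin' M) μ ≠ ⊥} = {μ : K | ∃ i : Fin (d + 1),
        μ = (((-1 : ℤ) ^ (e + (i : ℕ)) * ((n : ℤ) - 2 * ((i : ℕ) : ℤ)) : ℤ) : K)} := by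
  refine spectrum_of_eigenvectors n d e (hnd.imp And.left fun h => by omega) M fun i => ?_
  have hdn : d ≤ n := by omega
  obtain ⟨a, b, rfl, hb, hab⟩ := exists_splitting (n := n) (i := i) (by omega)
  rw [pow_add, mul_assoc, hab]
  push_cast
  refine exists_eigenvector_kac hdn _ t ε hε ?_ M hM
  rcases hnd with ⟨-, hn, rfl⟩ | ⟨hn, rfl⟩
  · simp [hn]
  · have h := krawtchouk_symm (K := K) (hb ⟨d, hn⟩) hdn
    rw [show a + b - d = d + 1 by omega] at h
    rw [h, hn]
    push_cast
    ring

end Spectrum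

/-- For the module of type `B(d)` (`d` even) each of `X, Y, Z`
is diagonalizable with eigenvalue set `{(−1)^i (d−2i) : 0 ≤ i ≤ d}`, and for
the module of type `AB(d,0)` each of `X, Y, Z` is diagonalizable with
eigenvalue set `{(−1)^{d+i}(2d−2i+1) : 0 ≤ i ≤ d}`. -/
theorem stmt9 (K : Type*) [Field K] [IsAlgClosed K] [CharZero K] (d : ℕ) :
    (Even d → ∀ M ∈ [matBX K d, matBY K d, matBZ K d],
        (⨆ μ : K, eigSp (Matrix.toLin' M) μ) = ⊤ ∧
        {μ : K | eigSp (Matrix.toLin' M) μ ≠ ⊥} =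
          {μ : K | ∃ i : Fin (d + 1),
            μ = ((((-1 : ℤ) ^ (i : ℕ)) * ((d : ℤ) - 2 * ((i : ℕ) : ℤ)) : ℤ) : K)}) ∧
    (∀ M ∈ [matABX K d, matABY K d, matABZ K d],
        (⨆ μ : K, eigSp (Matrix.toLin' M) μ) = ⊤ ∧
        {μ : K | eigSp (Matrix.toLin' M) μ ≠ ⊥} =
          {μ : K | ∃ i : Fin (d + 1),
            μ = ((((-1 : ℤ) ^ (d + (i : ℕ))) *
              (2 * (d : ℤ) - 2 * ((i : ℕ) : ℤ) + 1) : ℤ) : K)}) := by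
  have hone : ∀ _ : ℕ, (1 : K) * 1 = 1 := fun _ => one_mul 1
  have hsign : ∀ e j : ℕ, (-1 : K) ^ (e + j) * (-1) ^ (e + j) = 1 := fun e j => by
    rw [← mul_pow]; simp
  constructor
  · intro hd M hM
    simp only [List.mem_cons, List.not_mem_nil, or_false] at hM
    rcases hM with rfl | rfl | rfl
    · simpa using spectrum_signedDiagonal d d 0 (.inl hd) (matBX K d) (by simp [matBX])
    · have h := spectrum_kac d d 0 (0 : K) (fun _ => 1) (.inl ⟨hd, rfl, rfl⟩) hone (matBY K d) ?_
      · simpa only [zero_add] using h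
      · intro j i
        unfold matBY
        split_ifs with h₁
        · simp only [← h₁]
          push_cast
          ring
        all_goals simp
    · have h := spectrum_kac d d 0 (0 : K) (fun j => (-1) ^ (0 + j)) (.inl ⟨hd, rfl, rfl⟩)
        (hsign 0) (matBZ K d) ?_
      · simpa only [zero_add] using h
      · intro j i
        unfold matBZ
        split_ifs with h₁
        · simp only [← h₁]
          push_cast
          ring
        all_goals simp
  · intro M hM
    simp only [List.mem_cons, List.not_mem_nil, or_false] at hM
    have hcast : ∀ i : ℕ, 2 * (d : ℤ) - 2 * (i : ℤ) + 1 = ((2 * d + 1 : ℕ) : ℤ) - 2 * i :=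
      fun i => by push_cast; ring
    simp only [hcast]
    have hdd : (-1 : K) ^ d * (-1) ^ d = 1 := by simpa only [zero_add] using hsign 0 d
    rcases hM with rfl | rfl | rfl
    · refine spectrum_signedDiagonal (2 * d + 1) d d (.inr (by omega)) (matABX K d) fun j i => ?_
      rw [matABX, hcast]
    · refine spectrum_kac (2 * d + 1) d d ((d : K) + 1) (fun _ => 1) (.inr ⟨rfl, rfl⟩) hone
        (matABY K d) fun j i => ?_
      unfold matABY
      split_ifs with h₁
      · simp only [← h₁]
        push_cast
        ring
      all_goals simp
    · refine spectrum_kac (2 * d + 1) d d ((d : K) + 1) (fun j => (-1) ^ (d + j))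
        (.inr ⟨rfl, rfl⟩) (hsign d) (matABZ K d) fun j i => ?_
      unfold matABZ
      split_ifs with h₁ h₂ h₃
      · simp only [← h₁, pow_add, ← mul_assoc, hdd]
        push_cast
        ring
      · simp only [pow_add, ← mul_assoc, hdd]
        push_cast
        ring
      · rw [h₃.2]
        push_cast
        ring
      · rfl
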